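/- Let U ⊆ ℝ³ be open, let Φ : U → ℝ³ be a C³ orthogonal curvilinear coordinate map (pairwise orthogonal nonvanishing partials, metric coefficients hᵢ, right-handed frame uᵢ), and let f⃗ ∈ C²(Ω; ℂ³) be a vector field on an open set Ω with Φ(U) ⊆ Ω, with component functions F₁,F₂,F₃ : U → ℂ defined by f⃗(Φ(q)) = F₁(q)u₁(q) + F₂(q)u₂(q) + F₃(q)u₃(q). Then for every q ∈ U the operator Δ̃⃗[f⃗] := grad[div[f⃗]] + curl[curl[f⃗]] satisfies: the u₁-component of Δ̃⃗[f⃗](Φ(q)) equals (1/h₁)∂/∂q₁[(1/(h₁h₂h₃))∂(h₂h₃F₁)/∂q₁] + (1/h₁)∂/∂q₁[(1/(h₁h₂h₃))∂(h₁h₃F₂)/∂q₂] + (1/h₁)∂/∂q₁[(1/(h₁h₂h₃))∂(h₁h₂F₃)/∂q₃] + (1/(h₂h₃))∂/∂q₂[(h₃/(h₁h₂))∂(h₂F₂)/∂q₁] − (1/(h₂h₃))∂/∂q₂[(h₃/(h₁h₂))∂(h₁F₁)/∂q₂] − (1/(h₂h₃))∂/∂q₃[(h₂/(h₁h₃))∂(h₁F₁)/∂q₃]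 + (1/(h₂h₃))∂/∂q₃[(h₂/(h₁h₃))∂(h₃F₃)/∂q₁], and the u₂- and u₃-components are obtained from this expression by the cyclic permutations (1→2→3→1) and (1→3→2→1) of all indices on h, F and q respectively. -/

import Mathlib

open Quaternion

noncomputable section

/-- Points of `ℝ³`. -/
abbrev P3 := Fin 3 → ℝ
/-- Vectors of `ℂ³`. -/
abbrev V3 := Fin 3 → ℂ

/-- Partial derivative `∂g/∂qᵢ` of a complex-valued function on `ℝ³`. -/
def pd (i : Fin 3) (g : P3 → ℂ) : P3 → ℂ := fun p => fderiv ℝ g p (Pi.single i 1)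

/-- Gradient of a scalar field, extended ℂ-linearly. -/
def grad (g : P3 → ℂ) : P3 → V3 := fun p => ![pd 0 g p, pd 1 g p, pd 2 g p]

/-- Divergence of a `ℂ³`-valued vector field. -/
def div3 (F : P3 → V3) : P3 → ℂ := fun p =>
  pd 0 (fun q => F q 0) p + pd 1 (fun q => F q 1) p + pd 2 (fun q => F q 2) p

/-- Curl of a `ℂ³`-valued vector field. -/
def curl (F : P3 → V3) : P3 → V3 := fun p =>
  ![pd 1 (fun q => F q 2) p - pd 2 (fun q => F q 1) p,
    pd 2 (fun q => F q 0) p - pd 0 (fun q => F q 2) p,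
    pd 0 (fun q => F q 1) p - pd 1 (fun q => F q 0) p]

/-- Scalar Laplacian `∂²/∂x² + ∂²/∂y² + ∂²/∂z²` of a complex-valued function. -/
def lap (g : P3 → ℂ) : P3 → ℂ := fun p =>
  pd 0 (pd 0 g) p + pd 1 (pd 1 g) p + pd 2 (pd 2 g) p

/-- A `ℂ³`-valued field is `Cⁿ` on a set iff each component is. -/
def VContDiffOn (n : ℕ) (F : P3 → V3) (Ω : Set P3) : Prop :=
  ∀ i : Fin 3, ContDiffOn ℝ n (fun q => F q i) Ω

/-- Real (bilinear) dot product on `ℝ³`. -/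
def dotR (v w : P3) : ℝ := v 0 * w 0 + v 1 * w 1 + v 2 * w 2

/-- Complex bilinear "inner product" on `ℂ³` (no conjugation). -/
def dotC (v w : V3) : ℂ := v 0 * w 0 + v 1 * w 1 + v 2 * w 2

/-- Cross product on `ℝ³`. -/
def crossR (v w : P3) : P3 :=
  ![v 1 * w 2 - v 2 * w 1, v 2 * w 0 - v 0 * w 2, v 0 * w 1 - v 1 * w 0]

/-- A real vector of `ℝ³` viewed inside `ℂ³`. -/
def c3 (v : P3) : V3 := fun i => (v i : ℂ)

/-- Partial derivative `∂Φ/∂qᵢ` of a map `Φ : ℝ³ → ℝ³`. -/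
def pdv (i : Fin 3) (Φ : P3 → P3) (q : P3) : P3 := fderiv ℝ Φ q (Pi.single i 1)

/-- `Φ` is an orthogonal curvilinear coordinate map on `U`: its partial derivatives
are pairwise orthogonal and nonvanishing at each point of `U`. -/
def IsOrthogonalCurvilinear (Φ : P3 → P3) (U : Set P3) : Prop :=
  ∀ q ∈ U, (∀ i j : Fin 3, i ≠ j → dotR (pdv i Φ q) (pdv j Φ q) = 0) ∧
    ∀ i : Fin 3, pdv i Φ q ≠ 0

/-- Metric (Lamé) coefficient `hᵢ(q) = ‖∂Φ/∂qᵢ(q)‖` (Euclidean norm). -/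
def mcoef (Φ : P3 → P3) (i : Fin 3) (q : P3) : ℝ :=
  Real.sqrt (dotR (pdv i Φ q) (pdv i Φ q))

/-- Orthonormal frame `uᵢ(q) = hᵢ(q)⁻¹ ∂Φ/∂qᵢ(q)`. -/
def frame (Φ : P3 → P3) (i : Fin 3) (q : P3) : P3 := (mcoef Φ i q)⁻¹ • pdv i Φ q

/-- The frame is right-handed: `u₁ × u₂ = u₃` on `U`. -/
def IsRightHanded (Φ : P3 → P3) (U : Set P3) : Prop :=
  ∀ q ∈ U, crossR (frame Φ 0 q) (frame Φ 1 q) = frame Φ 2 q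

/-- Frame vector `uᵢ(q)` viewed inside `ℂ³`. -/
def frameC (Φ : P3 → P3) (i : Fin 3) (q : P3) : V3 := c3 (frame Φ i q)

/-- Metric coefficient `hᵢ(q)` viewed as a complex number. -/
def hC (Φ : P3 → P3) (i : Fin 3) (q : P3) : ℂ := ((mcoef Φ i q : ℝ) : ℂ)


/-- The generic `uᵢ`-component expression for the operator
`Δ̃⃗ = grad∘div + curl∘curl` (the vector part of the generalization of the Bitsadze
operator to `ℝ³`) in orthogonal curvilinear coordinates; the components are obtained
by the cyclic substitutions `(i,j,k) = (1,2,3), (2,3,1), (3,1,2)`. -/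
def bitsadzeCurvExpr (Φ : P3 → P3) (F : Fin 3 → P3 → ℂ) (i j k : Fin 3) : P3 → ℂ := fun q =>
    (1 / hC Φ i q) *
      pd i (fun r => (1 / (hC Φ i r * hC Φ j r * hC Φ k r)) *
        pd i (fun s => hC Φ j s * hC Φ k s * F i s) r) q
    + (1 / hC Φ i q) *
      pd i (fun r => (1 / (hC Φ i r * hC Φ j r * hC Φ k r)) *
        pd j (fun s => hC Φ i s * hC Φ k s * F j s) r) q
    + (1 / hC Φ i q) *
      pd i (fun r => (1 / (hC Φ i r * hC Φ j r * hC Φ k r)) *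
        pd k (fun s => hC Φ i s * hC Φ j s * F k s) r) q
    + (1 / (hC Φ j q * hC Φ k q)) *
      pd j (fun r => (hC Φ k r / (hC Φ i r * hC Φ j r)) *
        pd i (fun s => hC Φ j s * F j s) r) q
    - (1 / (hC Φ j q * hC Φ k q)) *
      pd j (fun r => (hC Φ k r / (hC Φ i r * hC Φ j r)) *
        pd j (fun s => hC Φ i s * F i s) r) q
    - (1 / (hC Φ j q * hC Φ k q)) *
      pd k (fun r => (hC Φ j r / (hC Φ i r * hC Φ k r)) *
        pd k (fun s => hC Φ i s * F i s) r) q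
    + (1 / (hC Φ j q * hC Φ k q)) *
      pd k (fun r => (hC Φ j r / (hC Φ i r * hC Φ k r)) *
        pd i (fun s => hC Φ k s * F k s) r) q

open scoped Topology

section PartialDerivatives

variable {g g' : P3 → ℂ} {q : P3} (i : Fin 3)

theorem pd_congr (h : g =ᶠ[𝓝 q] g') : pd i g q = pd i g' q := by
  simp only [pd, h.fderiv_eq]

theorem pd_add (hg : DifferentiableAt ℝ g q) (hg' : DifferentiableAt ℝ g' q) :
    pd i (fun s => g s + g' s) q = pd i g q + pd i g' q := by
  simp [pd, fderiv_fun_add hg hg']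

theorem pd_sub (hg : DifferentiableAt ℝ g q) (hg' : DifferentiableAt ℝ g' q) :
    pd i (fun s => g s - g' s) q = pd i g q - pd i g' q := by
  simp [pd, fderiv_fun_sub hg hg']

theorem pd_mul (hg : DifferentiableAt ℝ g q) (hg' : DifferentiableAt ℝ g' q) :
    pd i (fun s => g s * g' s) q = pd i g q * g' q + g q * pd i g' q := by
  simp [pd, fderiv_fun_mul hg hg']
  ring

theorem contDiffAt_pd {m n : WithTop ℕ∞} (hg : ContDiffAt ℝ n g q) (hmn : m + 1 ≤ n) :
    ContDiffAt ℝ m (pd i g) q :=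
  (hg.fderiv_right hmn).clm_apply contDiffAt_const

end PartialDerivatives

section CoordinateMap

variable {Φ : P3 → P3} {q : P3}

theorem contDiffAt_pdv {m n : WithTop ℕ∞} (hΦ : ContDiffAt ℝ n Φ q) (hmn : m + 1 ≤ n)
    (i a : Fin 3) : ContDiffAt ℝ m (fun s => pdv i Φ s a) q :=
  contDiffAt_pi.1 ((hΦ.fderiv_right hmn).clm_apply contDiffAt_const) a

theorem ContDiffAt.complex_ofReal {n : WithTop ℕ∞} {g : P3 → ℝ} (hg : ContDiffAt ℝ n g q) :
    ContDiffAt ℝ n (fun s => (g s : ℂ)) q :=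
  Complex.ofRealCLM.contDiff.contDiffAt.comp q hg

theorem pd_ofReal_pdv (hΦ : ContDiffAt ℝ 2 Φ q) (i j a : Fin 3) :
    pd i (fun s => (pdv j Φ s a : ℂ)) q =
      (fderiv ℝ (fderiv ℝ Φ) q (Pi.single i 1) (Pi.single j 1) a : ℝ) := by
  have h1 : HasFDerivAt (fderiv ℝ Φ) (fderiv ℝ (fderiv ℝ Φ) q) q :=
    ((hΦ.fderiv_right (m := 1) (by norm_num)).differentiableAt (by norm_num)).hasFDerivAt
  have h2 := hasFDerivAt_pi'.1 (h1.clm_apply (hasFDerivAt_const (Pi.single j (1 : ℝ)) q)) a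
  have h3 := Complex.ofRealCLM.hasFDerivAt.comp q h2
  have h4 : HasFDerivAt (fun s => (pdv j Φ s a : ℂ)) _ q := h3
  rw [pd, h4.fderiv]
  simp

/-- Symmetry of the second partial derivatives of `Φ`. -/
theorem pd_pdv_comm (hΦ : ContDiffAt ℝ 2 Φ q) (i j a : Fin 3) :
    pd i (fun s => (pdv j Φ s a : ℂ)) q = pd j (fun s => (pdv i Φ s a : ℂ)) q := by
  rw [pd_ofReal_pdv hΦ, pd_ofReal_pdv hΦ, (hΦ.isSymmSndFDerivAt (by simp)).eq]

/-- Chain rule for a scalar field along `Φ`. -/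
theorem pd_comp {g : P3 → ℂ} (hΦ : DifferentiableAt ℝ Φ q) (hg : DifferentiableAt ℝ g (Φ q))
    (i : Fin 3) : pd i (fun s => g (Φ s)) q =
      pd 0 g (Φ q) * pdv i Φ q 0 + pd 1 g (Φ q) * pdv i Φ q 1 + pd 2 g (Φ q) * pdv i Φ q 2 := by
  have h := hg.hasFDerivAt.comp q hΦ.hasFDerivAt
  have h' : HasFDerivAt (fun s => g (Φ s)) _ q := h
  have hv : fderiv ℝ Φ q (Pi.single i 1) =
      pdv i Φ q 0 • Pi.single 0 1 + pdv i Φ q 1 • Pi.single 1 1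
        + pdv i Φ q 2 • Pi.single 2 1 := by
    ext a
    fin_cases a <;> simp [pdv]
  rw [pd, h'.fderiv, ContinuousLinearMap.comp_apply, hv]
  simp only [map_add, map_smul, Complex.real_smul, pd]
  ring

theorem dotC_grad_pdv {g : P3 → ℂ} (hΦ : DifferentiableAt ℝ Φ q)
    (hg : DifferentiableAt ℝ g (Φ q)) (i : Fin 3) :
    dotC (grad g (Φ q)) (c3 (pdv i Φ q)) = pd i (fun s => g (Φ s)) q := by
  rw [pd_comp hΦ hg]
  simp [dotC, grad, c3]

variable {f : P3 → V3}

/-- The curl in curvilinear coordinates, in terms of covariant components. -/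
theorem pd_dotC_pdv_sub (hΦ : ContDiffAt ℝ 2 Φ q)
    (hf : ∀ a, DifferentiableAt ℝ (fun p => f p a) (Φ q)) (j k : Fin 3) :
    pd j (fun s => dotC (f (Φ s)) (c3 (pdv k Φ s))) q
        - pd k (fun s => dotC (f (Φ s)) (c3 (pdv j Φ s))) q =
      dotC (curl f (Φ q)) (c3 (crossR (pdv j Φ q) (pdv k Φ q))) := by
  have hΦd : DifferentiableAt ℝ Φ q := hΦ.differentiableAt (by norm_num)
  have hfd : ∀ a, DifferentiableAt ℝ (fun s => f (Φ s) a) q := fun a => (hf a).comp q hΦd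
  have hpd : ∀ i a, DifferentiableAt ℝ (fun s => (pdv i Φ s a : ℂ)) q := fun i a =>
    (contDiffAt_pdv (m := 1) hΦ (by norm_num) i a).complex_ofReal.differentiableAt (by norm_num)
  have key : ∀ i l, pd i (fun s => dotC (f (Φ s)) (c3 (pdv l Φ s))) q =
      pd i (fun s => f (Φ s) 0) q * pdv l Φ q 0
        + f (Φ q) 0 * pd i (fun s => (pdv l Φ s 0 : ℂ)) q
      + (pd i (fun s => f (Φ s) 1) q * pdv l Φ q 1
        + f (Φ q) 1 * pd i (fun s => (pdv l Φ s 1 : ℂ)) q)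
      + (pd i (fun s => f (Φ s) 2) q * pdv l Φ q 2
        + f (Φ q) 2 * pd i (fun s => (pdv l Φ s 2 : ℂ)) q) := by
    intro i l
    simp only [dotC, c3]
    rw [pd_add i (((hfd 0).fun_mul (hpd l 0)).fun_add ((hfd 1).fun_mul (hpd l 1)))
        ((hfd 2).fun_mul (hpd l 2)),
      pd_add i ((hfd 0).fun_mul (hpd l 0)) ((hfd 1).fun_mul (hpd l 1)),
      pd_mul i (hfd 0) (hpd l 0), pd_mul i (hfd 1) (hpd l 1), pd_mul i (hfd 2) (hpd l 2)]
  rw [key j k, key k j, pd_pdv_comm hΦ k j 0, pd_pdv_comm hΦ k j 1, pd_pdv_comm hΦ k j 2]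
  simp only [fun a l => pd_comp hΦd (hf a) l]
  simp [dotC, c3, curl, crossR]
  ring

/-- The divergence in curvilinear coordinates (Piola identity). -/
theorem pd_dotC_crossR_add (hΦ : ContDiffAt ℝ 2 Φ q)
    (hf : ∀ a, DifferentiableAt ℝ (fun p => f p a) (Φ q)) :
    pd 0 (fun s => dotC (f (Φ s)) (c3 (crossR (pdv 1 Φ s) (pdv 2 Φ s)))) q
        + pd 1 (fun s => dotC (f (Φ s)) (c3 (crossR (pdv 2 Φ s) (pdv 0 Φ s)))) q
        + pd 2 (fun s => dotC (f (Φ s)) (c3 (crossR (pdv 0 Φ s) (pdv 1 Φ s)))) q =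
      div3 f (Φ q) * (dotR (crossR (pdv 0 Φ q) (pdv 1 Φ q)) (pdv 2 Φ q) : ℝ) := by
  have hΦd : DifferentiableAt ℝ Φ q := hΦ.differentiableAt (by norm_num)
  have hfd : ∀ a, DifferentiableAt ℝ (fun s => f (Φ s) a) q := fun a => (hf a).comp q hΦd
  have hpd : ∀ i a, DifferentiableAt ℝ (fun s => (pdv i Φ s a : ℂ)) q := fun i a =>
    (contDiffAt_pdv (m := 1) hΦ (by norm_num) i a).complex_ofReal.differentiableAt (by norm_num)
  have minor : ∀ i l m a b c, pd i (fun s => f (Φ s) c *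
      ((pdv l Φ s a : ℂ) * pdv m Φ s b - (pdv l Φ s b : ℂ) * pdv m Φ s a)) q =
      pd i (fun s => f (Φ s) c) q *
        ((pdv l Φ q a : ℂ) * pdv m Φ q b - (pdv l Φ q b : ℂ) * pdv m Φ q a)
      + f (Φ q) c * (pd i (fun s => (pdv l Φ s a : ℂ)) q * pdv m Φ q b
        + pdv l Φ q a * pd i (fun s => (pdv m Φ s b : ℂ)) q
        - (pd i (fun s => (pdv l Φ s b : ℂ)) q * pdv m Φ q a
        + pdv l Φ q b * pd i (fun s => (pdv m Φ s a : ℂ)) q)) := by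
    intro i l m a b c
    rw [pd_mul i (hfd c) (((hpd l a).fun_mul (hpd m b)).fun_sub ((hpd l b).fun_mul (hpd m a))),
      pd_sub i ((hpd l a).fun_mul (hpd m b)) ((hpd l b).fun_mul (hpd m a)),
      pd_mul i (hpd l a) (hpd m b), pd_mul i (hpd l b) (hpd m a)]
  have hd : ∀ l m a b c, DifferentiableAt ℝ (fun s => f (Φ s) c *
      ((pdv l Φ s a : ℂ) * pdv m Φ s b - (pdv l Φ s b : ℂ) * pdv m Φ s a)) q :=
    fun l m a b c => (hfd c).mul (((hpd l a).mul (hpd m b)).sub ((hpd l b).mul (hpd m a)))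
  have key : ∀ i l m, pd i (fun s => dotC (f (Φ s)) (c3 (crossR (pdv l Φ s) (pdv m Φ s)))) q =
      pd i (fun s => f (Φ s) 0 *
        ((pdv l Φ s 1 : ℂ) * pdv m Φ s 2 - (pdv l Φ s 2 : ℂ) * pdv m Φ s 1)) q
      + pd i (fun s => f (Φ s) 1 *
        ((pdv l Φ s 2 : ℂ) * pdv m Φ s 0 - (pdv l Φ s 0 : ℂ) * pdv m Φ s 2)) q
      + pd i (fun s => f (Φ s) 2 *
        ((pdv l Φ s 0 : ℂ) * pdv m Φ s 1 - (pdv l Φ s 1 : ℂ) * pdv m Φ s 0)) q := by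
    intro i l m
    rw [← pd_add i (hd l m 1 2 0) (hd l m 2 0 1),
      ← pd_add i ((hd l m 1 2 0).fun_add (hd l m 2 0 1)) (hd l m 0 1 2)]
    congr 1
    funext s
    simp [dotC, c3, crossR]
  rw [key 0 1 2, key 1 2 0, key 2 0 1]
  simp only [minor, fun a => pd_pdv_comm hΦ 1 0 a, fun a => pd_pdv_comm hΦ 2 0 a,
    fun a => pd_pdv_comm hΦ 2 1 a, fun a l => pd_comp hΦd (hf a) l]
  simp [div3, dotR, crossR]
  ring

end CoordinateMap

section Frame

theorem dotR_self_pos {v : P3} (hv : v ≠ 0) : 0 < dotR v v := by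
  obtain ⟨a, ha⟩ := Function.ne_iff.1 hv
  have : 0 < v a * v a := mul_self_pos.2 ha
  have h0 := mul_self_nonneg (v 0)
  have h1 := mul_self_nonneg (v 1)
  have h2 := mul_self_nonneg (v 2)
  unfold dotR
  fin_cases a <;> simp only [Fin.zero_eta, Fin.mk_one, Fin.reduceFinMk] at this <;> linarith

theorem crossR_cycle {u v w : P3} (huv : dotR u v = 0) (hv : dotR v v = 1)
    (h : crossR u v = w) : crossR v w = u := by
  subst h
  unfold dotR at huv hv
  ext a
  fin_cases a <;> simp [crossR]
  · linear_combination u 0 * hv - v 0 * huv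
  · linear_combination u 1 * hv - v 1 * huv
  · linear_combination u 2 * hv - v 2 * huv

theorem crossR_smul_smul (a b : ℝ) (v w : P3) :
    crossR (a • v) (b • w) = (a * b) • crossR v w := by
  ext i
  fin_cases i <;> simp [crossR] <;> ring

theorem dotC_smul (v : V3) (a : ℝ) (w : P3) : dotC v (c3 (a • w)) = a * dotC v (c3 w) := by
  simp [dotC, c3]
  ring

theorem dotC_add_left (v v' w : V3) : dotC (v + v') w = dotC v w + dotC v' w := by
  simp [dotC]
  ring

variable {Φ : P3 → P3} {U : Set P3} {q : P3}

theorem mcoef_pos (horth : IsOrthogonalCurvilinear Φ U) (hq : q ∈ U) (i : Fin 3) :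
    0 < mcoef Φ i q :=
  Real.sqrt_pos.2 (dotR_self_pos ((horth q hq).2 i))

theorem hC_ne_zero (horth : IsOrthogonalCurvilinear Φ U) (hq : q ∈ U) (i : Fin 3) :
    hC Φ i q ≠ 0 :=
  Complex.ofReal_ne_zero.2 (mcoef_pos horth hq i).ne'

theorem pdv_eq_smul_frame (horth : IsOrthogonalCurvilinear Φ U) (hq : q ∈ U) (i : Fin 3) :
    pdv i Φ q = mcoef Φ i q • frame Φ i q := by
  rw [frame, smul_inv_smul₀ (mcoef_pos horth hq i).ne']

theorem dotR_frame_self (horth : IsOrthogonalCurvilinear Φ U) (hq : q ∈ U) (i : Fin 3) :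
    dotR (frame Φ i q) (frame Φ i q) = 1 := by
  have h := mcoef_pos horth hq i
  have hs : mcoef Φ i q * mcoef Φ i q = dotR (pdv i Φ q) (pdv i Φ q) :=
    Real.mul_self_sqrt (dotR_self_pos ((horth q hq).2 i)).le
  unfold dotR at hs ⊢
  simp only [frame, Pi.smul_apply, smul_eq_mul]
  field_simp
  linarith

theorem dotR_frame_of_ne (horth : IsOrthogonalCurvilinear Φ U) (hq : q ∈ U) {i j : Fin 3}
    (hij : i ≠ j) : dotR (frame Φ i q) (frame Φ j q) = 0 := by
  have h := (horth q hq).1 i j hij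
  unfold dotR at h ⊢
  simp only [frame, Pi.smul_apply, smul_eq_mul]
  linear_combination (mcoef Φ i q)⁻¹ * (mcoef Φ j q)⁻¹ * h

theorem dotC_frameC (i j : Fin 3) :
    dotC (frameC Φ i q) (frameC Φ j q) = (dotR (frame Φ i q) (frame Φ j q) : ℝ) := by
  simp [dotC, dotR, frameC, c3]

theorem dotC_pdv (horth : IsOrthogonalCurvilinear Φ U) (hq : q ∈ U) (v : V3) (i : Fin 3) :
    dotC v (c3 (pdv i Φ q)) = hC Φ i q * dotC v (frameC Φ i q) := by
  rw [pdv_eq_smul_frame horth hq, dotC_smul, hC, frameC]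

theorem dotC_crossR_pdv (horth : IsOrthogonalCurvilinear Φ U) (hq : q ∈ U) {i j k : Fin 3}
    (h : crossR (frame Φ j q) (frame Φ k q) = frame Φ i q) (v : V3) :
    dotC v (c3 (crossR (pdv j Φ q) (pdv k Φ q))) =
      hC Φ j q * hC Φ k q * dotC v (frameC Φ i q) := by
  rw [pdv_eq_smul_frame horth hq, pdv_eq_smul_frame horth hq, crossR_smul_smul, h, dotC_smul,
    hC, hC, frameC, Complex.ofReal_mul]

theorem dotC_frame_decomposition (horth : IsOrthogonalCurvilinear Φ U) (hq : q ∈ U)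
    (c : Fin 3 → ℂ) (i : Fin 3) :
    dotC (c 0 • frameC Φ 0 q + c 1 • frameC Φ 1 q + c 2 • frameC Φ 2 q) (frameC Φ i q) = c i := by
  have h : dotC (c 0 • frameC Φ 0 q + c 1 • frameC Φ 1 q + c 2 • frameC Φ 2 q) (frameC Φ i q) =
      c 0 * dotC (frameC Φ 0 q) (frameC Φ i q) + c 1 * dotC (frameC Φ 1 q) (frameC Φ i q)
        + c 2 * dotC (frameC Φ 2 q) (frameC Φ i q) := by
    simp [dotC]
    ring
  rw [h]
  simp only [dotC_frameC]
  fin_cases i <;> simp [dotR_frame_self horth hq, dotR_frame_of_ne horth hq]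

theorem contDiffAt_mcoef (horth : IsOrthogonalCurvilinear Φ U) (hq : q ∈ U)
    (hΦ : ContDiffAt ℝ 3 Φ q) (i : Fin 3) : ContDiffAt ℝ 2 (mcoef Φ i) q := by
  have h a := contDiffAt_pdv (m := 2) hΦ (by norm_num) i a
  refine ContDiffAt.sqrt ?_ (dotR_self_pos ((horth q hq).2 i)).ne'
  exact (((h 0).mul (h 0)).add ((h 1).mul (h 1))).add ((h 2).mul (h 2))

theorem contDiffAt_frameC (horth : IsOrthogonalCurvilinear Φ U) (hq : q ∈ U)
    (hΦ : ContDiffAt ℝ 3 Φ q) (i a : Fin 3) : ContDiffAt ℝ 2 (fun s => frameC Φ i s a) q :=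
  ContDiffAt.complex_ofReal <|
    ((contDiffAt_mcoef horth hq hΦ i).inv (mcoef_pos horth hq i).ne').mul
      (contDiffAt_pdv (m := 2) hΦ (by norm_num) i a)

end Frame

section CurvilinearFormulas

variable {U : Set P3} {Φ : P3 → P3} {f : P3 → V3} {q : P3}

theorem dotC_grad_frameC (horth : IsOrthogonalCurvilinear Φ U) (hq : q ∈ U) {g : P3 → ℂ}
    (hΦ : DifferentiableAt ℝ Φ q) (hg : DifferentiableAt ℝ g (Φ q)) (i : Fin 3) :
    dotC (grad g (Φ q)) (frameC Φ i q) = 1 / hC Φ i q * pd i (fun s => g (Φ s)) q := by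
  have h := hC_ne_zero horth hq i
  rw [← dotC_grad_pdv hΦ hg, dotC_pdv horth hq]
  field_simp

theorem dotC_curl_frameC (hU : IsOpen U) (horth : IsOrthogonalCurvilinear Φ U) (hq : q ∈ U)
    (hΦ : ContDiffAt ℝ 2 Φ q) (hf : ∀ a, DifferentiableAt ℝ (fun p => f p a) (Φ q))
    {G : Fin 3 → P3 → ℂ} (hG : ∀ i, ∀ s ∈ U, G i s = dotC (f (Φ s)) (frameC Φ i s))
    {i j k : Fin 3} (h : crossR (frame Φ j q) (frame Φ k q) = frame Φ i q) :
    dotC (curl f (Φ q)) (frameC Φ i q) = 1 / (hC Φ j q * hC Φ k q) *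
      (pd j (fun s => hC Φ k s * G k s) q - pd k (fun s => hC Φ j s * G j s) q) := by
  have hj := hC_ne_zero horth hq j
  have hk := hC_ne_zero horth hq k
  have e : ∀ l, (fun s => hC Φ l s * G l s) =ᶠ[𝓝 q] fun s => dotC (f (Φ s)) (c3 (pdv l Φ s)) := by
    intro l
    filter_upwards [hU.mem_nhds hq] with s hs
    rw [dotC_pdv horth hs, hG l s hs]
  rw [pd_congr j (e k), pd_congr k (e j), pd_dotC_pdv_sub hΦ hf, dotC_crossR_pdv horth hq h]
  field_simp

theorem div3_curvilinear (hU : IsOpen U) (horth : IsOrthogonalCurvilinear Φ U) (hq : q ∈ U)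
    (hcross : ∀ s ∈ U, crossR (frame Φ 1 s) (frame Φ 2 s) = frame Φ 0 s ∧
      crossR (frame Φ 2 s) (frame Φ 0 s) = frame Φ 1 s ∧
      crossR (frame Φ 0 s) (frame Φ 1 s) = frame Φ 2 s)
    (hΦ : ContDiffAt ℝ 2 Φ q) (hf : ∀ a, DifferentiableAt ℝ (fun p => f p a) (Φ q))
    {G : Fin 3 → P3 → ℂ} (hG : ∀ i, ∀ s ∈ U, G i s = dotC (f (Φ s)) (frameC Φ i s)) :
    div3 f (Φ q) = 1 / (hC Φ 0 q * hC Φ 1 q * hC Φ 2 q) *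
      (pd 0 (fun s => hC Φ 1 s * hC Φ 2 s * G 0 s) q
        + pd 1 (fun s => hC Φ 2 s * hC Φ 0 s * G 1 s) q
        + pd 2 (fun s => hC Φ 0 s * hC Φ 1 s * G 2 s) q) := by
  have e : ∀ i j k, (∀ s ∈ U, crossR (frame Φ j s) (frame Φ k s) = frame Φ i s) →
      (fun s => hC Φ j s * hC Φ k s * G i s) =ᶠ[𝓝 q]
        fun s => dotC (f (Φ s)) (c3 (crossR (pdv j Φ s) (pdv k Φ s))) := by
    intro i j k h
    filter_upwards [hU.mem_nhds hq] with s hs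
    rw [dotC_crossR_pdv horth hs (h s hs), hG i s hs]
  rw [pd_congr 0 (e 0 1 2 fun s hs => (hcross s hs).1),
    pd_congr 1 (e 1 2 0 fun s hs => (hcross s hs).2.1),
    pd_congr 2 (e 2 0 1 fun s hs => (hcross s hs).2.2), pd_dotC_crossR_add hΦ hf]
  have hdet : dotR (crossR (pdv 0 Φ q) (pdv 1 Φ q)) (pdv 2 Φ q) =
      mcoef Φ 0 q * mcoef Φ 1 q * mcoef Φ 2 q := by
    have h2 := dotR_frame_self horth hq 2
    simp only [pdv_eq_smul_frame horth hq, crossR_smul_smul, (hcross q hq).2.2]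
    unfold dotR at h2 ⊢
    simp only [Pi.smul_apply, smul_eq_mul]
    linear_combination mcoef Φ 0 q * mcoef Φ 1 q * mcoef Φ 2 q * h2
  have h0 := hC_ne_zero horth hq 0
  have h1 := hC_ne_zero horth hq 1
  have h2 := hC_ne_zero horth hq 2
  rw [hdet]
  simp only [Complex.ofReal_mul]
  change _ = _ * (_ * (hC Φ 0 q * hC Φ 1 q * hC Φ 2 q))
  field_simp

/-- One frame component of the operator, given the curvilinear divergence formula and the
orientation of the frame. -/
theorem dotC_bitsadze_frameC {Ω : Set P3} (hU : IsOpen U) (hΩ : IsOpen Ω)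
    (hΦ : ContDiffOn ℝ 3 Φ U) (horth : IsOrthogonalCurvilinear Φ U)
    (hΦΩ : ∀ s ∈ U, Φ s ∈ Ω) (hf : VContDiffOn 2 f Ω)
    {F : Fin 3 → P3 → ℂ} (hF : ∀ l, ∀ s ∈ U, F l s = dotC (f (Φ s)) (frameC Φ l s))
    {i j k : Fin 3} (hi : ∀ s ∈ U, crossR (frame Φ j s) (frame Φ k s) = frame Φ i s)
    (hj : ∀ s ∈ U, crossR (frame Φ k s) (frame Φ i s) = frame Φ j s)
    (hk : ∀ s ∈ U, crossR (frame Φ i s) (frame Φ j s) = frame Φ k s)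
    (hdiv : ∀ s ∈ U, div3 f (Φ s) = 1 / (hC Φ i s * hC Φ j s * hC Φ k s) *
      (pd i (fun s => hC Φ j s * hC Φ k s * F i s) s
        + pd j (fun s => hC Φ i s * hC Φ k s * F j s) s
        + pd k (fun s => hC Φ i s * hC Φ j s * F k s) s))
    (hq : q ∈ U) :
    dotC (grad (div3 f) (Φ q) + curl (curl f) (Φ q)) (frameC Φ i q) =
      bitsadzeCurvExpr Φ F i j k q := by
  have hΦat : ∀ s ∈ U, ContDiffAt ℝ 3 Φ s := fun s hs => hΦ.contDiffAt (hU.mem_nhds hs)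
  have hΦ2 : ∀ s ∈ U, ContDiffAt ℝ 2 Φ s := fun s hs => (hΦat s hs).of_le (by norm_num)
  have hfat : ∀ s ∈ U, ∀ a, ContDiffAt ℝ 2 (fun p => f p a) (Φ s) := fun s hs a =>
    (hf a).contDiffAt (hΩ.mem_nhds (hΦΩ s hs))
  have hfd : ∀ s ∈ U, ∀ a, DifferentiableAt ℝ (fun p => f p a) (Φ s) := fun s hs a =>
    (hfat s hs a).differentiableAt (by norm_num)
  have hpdf : ∀ l a, DifferentiableAt ℝ (pd l fun p => f p a) (Φ q) := fun l a =>
    (contDiffAt_pd (m := 1) l (hfat q hq a) (by norm_num)).differentiableAt (by norm_num)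
  have hdivd : DifferentiableAt ℝ (div3 f) (Φ q) :=
    ((hpdf 0 0).add (hpdf 1 1)).add (hpdf 2 2)
  have hcurld : ∀ a, DifferentiableAt ℝ (fun p => curl f p a) (Φ q) := by
    intro a
    fin_cases a
    · exact (hpdf 1 2).sub (hpdf 2 1)
    · exact (hpdf 2 0).sub (hpdf 0 2)
    · exact (hpdf 0 1).sub (hpdf 1 0)
  have hh : ∀ l, ContDiffAt ℝ 2 (hC Φ l) q := fun l =>
    (contDiffAt_mcoef horth hq (hΦat q hq) l).complex_ofReal
  have hF2 : ∀ l, ContDiffAt ℝ 2 (F l) q := by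
    intro l
    have hterm : ∀ a, ContDiffAt ℝ 2 (fun s => f (Φ s) a * frameC Φ l s a) q := fun a =>
      ((hfat q hq a).comp q (hΦ2 q hq)).mul (contDiffAt_frameC horth hq (hΦat q hq) l a)
    refine (((hterm 0).add (hterm 1)).add (hterm 2)).congr_of_eventuallyEq ?_
    filter_upwards [hU.mem_nhds hq] with s hs
    rw [hF l s hs, dotC]
  have hne := hC_ne_zero horth hq
  have hhd : ∀ l, DifferentiableAt ℝ (hC Φ l) q := fun l => (hh l).differentiableAt (by norm_num)
  have hpd1 : ∀ m l, DifferentiableAt ℝ (pd m fun s => hC Φ l s * F l s) q := fun m l =>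
    (contDiffAt_pd (m := 1) m ((hh l).mul (hF2 l)) (by norm_num)).differentiableAt (by norm_num)
  have hpd2 : ∀ m a b, DifferentiableAt ℝ (pd m fun s => hC Φ a s * hC Φ b s * F m s) q :=
    fun m a b => (contDiffAt_pd (m := 1) m (((hh a).mul (hh b)).mul (hF2 m))
      (by norm_num)).differentiableAt (by norm_num)
  have hcoef : DifferentiableAt ℝ (fun r => 1 / (hC Φ i r * hC Φ j r * hC Φ k r)) q := by
    simpa only [one_div] using (((hhd i).fun_mul (hhd j)).fun_mul (hhd k)).fun_inv
      (mul_ne_zero (mul_ne_zero (hne i) (hne j)) (hne k))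
  have hcoef' : ∀ a b c, DifferentiableAt ℝ (fun r => hC Φ a r / (hC Φ b r * hC Φ c r)) q := by
    intro a b c
    simpa only [div_eq_mul_inv] using
      (hhd a).fun_mul (((hhd b).fun_mul (hhd c)).fun_inv (mul_ne_zero (hne b) (hne c)))
  have hgrad : pd i (fun s => div3 f (Φ s)) q =
      pd i (fun r => (1 / (hC Φ i r * hC Φ j r * hC Φ k r)) *
          pd i (fun s => hC Φ j s * hC Φ k s * F i s) r) q
        + pd i (fun r => (1 / (hC Φ i r * hC Φ j r * hC Φ k r)) *
          pd j (fun s => hC Φ i s * hC Φ k s * F j s) r) q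
        + pd i (fun r => (1 / (hC Φ i r * hC Φ j r * hC Φ k r)) *
          pd k (fun s => hC Φ i s * hC Φ j s * F k s) r) q := by
    rw [← pd_add i (hcoef.fun_mul (hpd2 i j k)) (hcoef.fun_mul (hpd2 j i k)),
      ← pd_add i ((hcoef.fun_mul (hpd2 i j k)).fun_add (hcoef.fun_mul (hpd2 j i k)))
        (hcoef.fun_mul (hpd2 k i j))]
    apply pd_congr
    filter_upwards [hU.mem_nhds hq] with s hs
    rw [hdiv s hs]
    ring
  have hcurl_k : pd j (fun s => hC Φ k s * dotC (curl f (Φ s)) (frameC Φ k s)) q =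
      pd j (fun r => (hC Φ k r / (hC Φ i r * hC Φ j r)) * pd i (fun s => hC Φ j s * F j s) r) q
        - pd j (fun r => (hC Φ k r / (hC Φ i r * hC Φ j r)) *
          pd j (fun s => hC Φ i s * F i s) r) q := by
    rw [← pd_sub j ((hcoef' k i j).fun_mul (hpd1 i j)) ((hcoef' k i j).fun_mul (hpd1 j i))]
    apply pd_congr
    filter_upwards [hU.mem_nhds hq] with s hs
    rw [dotC_curl_frameC hU horth hs (hΦ2 s hs) (hfd s hs) hF (hk s hs)]
    ring
  have hcurl_j : pd k (fun s => hC Φ j s * dotC (curl f (Φ s)) (frameC Φ j s)) q =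
      pd k (fun r => (hC Φ j r / (hC Φ i r * hC Φ k r)) * pd k (fun s => hC Φ i s * F i s) r) q
        - pd k (fun r => (hC Φ j r / (hC Φ i r * hC Φ k r)) *
          pd i (fun s => hC Φ k s * F k s) r) q := by
    rw [← pd_sub k ((hcoef' j i k).fun_mul (hpd1 k i)) ((hcoef' j i k).fun_mul (hpd1 i k))]
    apply pd_congr
    filter_upwards [hU.mem_nhds hq] with s hs
    rw [dotC_curl_frameC hU horth hs (hΦ2 s hs) (hfd s hs) hF (hj s hs)]
    ring
  rw [dotC_add_left,
    dotC_grad_frameC horth hq ((hΦ2 q hq).differentiableAt (by norm_num)) hdivd,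
    dotC_curl_frameC hU horth hq (hΦ2 q hq) hcurld (f := curl f)
      (G := fun l s => dotC (curl f (Φ s)) (frameC Φ l s)) (fun _ _ _ => rfl) (hi q hq),
    hgrad, hcurl_k, hcurl_j, bitsadzeCurvExpr]
  ring

end CurvilinearFormulas

/-- Let `Φ` be a `C³` orthogonal curvilinear coordinate map on the
open set `U`, with metric coefficients `hᵢ` and right-handed frame `uᵢ`, and let
`f⃗ ∈ C²(Ω; ℂ³)` with `Φ(U) ⊆ Ω` have curvilinear components `F₁, F₂, F₃`
(indexed here by `F 0, F 1, F 2`).  Then for every `q ∈ U` the `uᵢ`-components of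
`Δ̃⃗[f⃗] = grad[div[f⃗]] + curl[curl[f⃗]]` at `Φ(q)` are given by the classical
curvilinear expression and its cyclic permutations. -/
theorem bitsadze_curvilinear (U Ω : Set P3) (hU : IsOpen U) (hΩ : IsOpen Ω)
    (Φ : P3 → P3) (hΦ : ContDiffOn ℝ 3 Φ U)
    (horth : IsOrthogonalCurvilinear Φ U) (hrh : IsRightHanded Φ U)
    (hΦΩ : ∀ q ∈ U, Φ q ∈ Ω)
    (fv : P3 → V3) (hfv : VContDiffOn 2 fv Ω)
    (F : Fin 3 → P3 → ℂ)
    (hdec : ∀ q ∈ U, fv (Φ q) =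
      F 0 q • frameC Φ 0 q + F 1 q • frameC Φ 1 q + F 2 q • frameC Φ 2 q) :
    ∀ q ∈ U,
      dotC (grad (div3 fv) (Φ q) + curl (curl fv) (Φ q)) (frameC Φ 0 q) =
          bitsadzeCurvExpr Φ F 0 1 2 q ∧
        dotC (grad (div3 fv) (Φ q) + curl (curl fv) (Φ q)) (frameC Φ 1 q) =
          bitsadzeCurvExpr Φ F 1 2 0 q ∧
        dotC (grad (div3 fv) (Φ q) + curl (curl fv) (Φ q)) (frameC Φ 2 q) =
          bitsadzeCurvExpr Φ F 2 0 1 q := by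
  have hF : ∀ l, ∀ s ∈ U, F l s = dotC (fv (Φ s)) (frameC Φ l s) := by
    intro l s hs
    rw [hdec s hs, dotC_frame_decomposition horth hs (fun i => F i s) l]
  have h2 : ∀ s ∈ U, crossR (frame Φ 0 s) (frame Φ 1 s) = frame Φ 2 s := hrh
  have h0 : ∀ s ∈ U, crossR (frame Φ 1 s) (frame Φ 2 s) = frame Φ 0 s := fun s hs =>
    crossR_cycle (dotR_frame_of_ne horth hs (by decide)) (dotR_frame_self horth hs 1) (h2 s hs)
  have h1 : ∀ s ∈ U, crossR (frame Φ 2 s) (frame Φ 0 s) = frame Φ 1 s := fun s hs =>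
    crossR_cycle (dotR_frame_of_ne horth hs (by decide)) (dotR_frame_self horth hs 2) (h0 s hs)
  have hdiv := fun s (hs : s ∈ U) => div3_curvilinear hU horth hs
    (fun s hs => ⟨h0 s hs, h1 s hs, h2 s hs⟩)
    ((hΦ.contDiffAt (hU.mem_nhds hs)).of_le (by norm_num))
    (fun a => ((hfv a).contDiffAt (hΩ.mem_nhds (hΦΩ s hs))).differentiableAt (by norm_num)) hF
  intro q hq
  refine ⟨dotC_bitsadze_frameC hU hΩ hΦ horth hΦΩ hfv hF h0 h1 h2 (fun s hs => ?_) hq,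
    dotC_bitsadze_frameC hU hΩ hΦ horth hΦΩ hfv hF h1 h2 h0 (fun s hs => ?_) hq,
    dotC_bitsadze_frameC hU hΩ hΦ horth hΦΩ hfv hF h2 h0 h1 (fun s hs => ?_) hq⟩
  · simp only [hdiv s hs, mul_comm (hC Φ 2 _) (hC Φ 0 _)]
  · simp only [hdiv s hs, mul_comm (hC Φ 2 _) (hC Φ 0 _), mul_comm (hC Φ 1 _) (hC Φ 0 _)]
    ring
  · simp only [hdiv s hs, mul_comm (hC Φ 2 _) (hC Φ 0 _), mul_comm (hC Φ 2 _) (hC Φ 1 _)]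
    ring
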